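/- Let (e_1,…,e_d) be an orthonormal basis of H, and let Γ : [0,T] → U(H) be continuously differentiable with Γ(0) = U₀. Then there exists a unique continuously differentiable Ũ : [0,T] → U(H) such that: (i) Ũ(0) = U₀; (ii) Ũ(t)|e_n⟩⟨e_n|Ũ(t)* = Γ(t)|e_n⟩⟨e_n|Γ(t)* for all n and all t ∈ [0,T]; and (iii) ⟨e_n, Ũ(t)⁻¹ Ũ'(t) e_n⟩ = 0 for all n and all t ∈ [0,T]. (Existence and uniqueness of the horizontal lift with prescribed initial point, for the canonical connection.) -/

import Mathlib

/- STATEMENT 15: Existence and uniqueness of the horizontal lift with prescribed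
initial point, for the canonical connection: given a C¹ curve Γ : [0,T] → U(H) with
Γ(0) = U₀, there is a unique C¹ curve Ũ : [0,T] → U(H) with Ũ(0) = U₀, lifting the
same curve of decompositions (Ũ|e_n⟩⟨e_n|Ũ* = Γ|e_n⟩⟨e_n|Γ*), and horizontal
(⟨e_n, Ũ⁻¹Ũ' e_n⟩ = 0). -/

noncomputable section

abbrev E (d : ℕ) : Type := EuclideanSpace ℂ (Fin d)
abbrev Op (d : ℕ) : Type := E d →L[ℂ] E d

/-- The rank-one operator `|x⟩⟨y| : h ↦ ⟨y, h⟩ x`. -/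
def rankOne {d : ℕ} (x y : E d) : Op d :=
  (ContinuousLinearMap.toSpanSingleton ℂ x).comp (innerSL ℂ y)

/-- The property of being a horizontal lift of the curve of decompositions of `Γ`
with initial point `U₀`, with derivative `W`. -/
def IsHorizontalLift (d : ℕ) (T : ℝ) (e : Fin d → E d) (Γ : ℝ → Op d)
    (U₀ : Op d) (V W : ℝ → Op d) : Prop :=
  (∀ t ∈ Set.Icc (0 : ℝ) T, HasDerivWithinAt V (W t) (Set.Icc (0 : ℝ) T) t) ∧
  ContinuousOn W (Set.Icc (0 : ℝ) T) ∧
  V 0 = U₀ ∧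
  (∀ t ∈ Set.Icc (0 : ℝ) T, V t ∈ unitary (Op d)) ∧
  (∀ n, ∀ t ∈ Set.Icc (0 : ℝ) T,
    V t * rankOne (e n) (e n) * star (V t) = Γ t * rankOne (e n) (e n) * star (Γ t)) ∧
  (∀ n, ∀ t ∈ Set.Icc (0 : ℝ) T,
    inner (𝕜 := ℂ) (e n) ((star (V t) * W t) (e n)) = (0 : ℂ))

open Set

section

variable {d : ℕ}

lemma rankOne_apply (x y h : E d) : rankOne x y h = inner ℂ y h • x := rfl

lemma mul_rankOne_mul_star (A : Op d) (x y : E d) :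
    A * rankOne x y * star A = rankOne (A x) (A y) := by
  ext1 h
  simp [rankOne_apply, ContinuousLinearMap.star_eq_adjoint,
    ContinuousLinearMap.adjoint_inner_right]

lemma inner_star_mul_apply (A B : Op d) (x y : E d) :
    inner ℂ x ((star A * B) y) = inner ℂ (A x) (B y) := by
  simp [ContinuousLinearMap.star_eq_adjoint, ContinuousLinearMap.adjoint_inner_right]

lemma inner_apply_of_mem_unitary {A : Op d} (hA : A ∈ unitary (Op d)) (x y : E d) :
    inner ℂ (A x) (A y) = inner ℂ x y := by
  rw [← inner_star_mul_apply, (Unitary.mem_iff.1 hA).1, one_apply_eq_self]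

lemma Orthonormal.exists_orthonormalBasis {e : Fin d → E d} (he : Orthonormal ℂ e) :
    ∃ b : OrthonormalBasis (Fin d) ℂ (E d), ⇑b = e := by
  have hsp : ⊤ ≤ Submodule.span ℂ (Set.range e) :=
    (he.linearIndependent.span_eq_top_of_card_eq_finrank' (by simp)).ge
  exact ⟨OrthonormalBasis.mk he hsp, OrthonormalBasis.coe_mk he hsp⟩

lemma Orthonormal.op_ext {e : Fin d → E d} (he : Orthonormal ℂ e) {A B : Op d}
    (h : ∀ n, A (e n) = B (e n)) : A = B := by
  obtain ⟨b, rfl⟩ := he.exists_orthonormalBasis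
  have := b.toBasis.ext (f₁ := (A : E d →ₗ[ℂ] E d)) (f₂ := B) (by simpa using h)
  exact ContinuousLinearMap.coe_injective this

/-- An operator mapping an orthonormal basis to an orthonormal family is unitary. -/
lemma Orthonormal.mem_unitary {e : Fin d → E d} (he : Orthonormal ℂ e) {A : Op d}
    (h : Orthonormal ℂ fun n => A (e n)) : A ∈ unitary (Op d) := by
  have h1 : star A * A = 1 := by
    refine he.op_ext fun n => ?_
    obtain ⟨b, rfl⟩ := he.exists_orthonormalBasis
    refine InnerProductSpace.ext_inner_left_basis b.toBasis fun m => ?_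
    rw [OrthonormalBasis.coe_toBasis, inner_star_mul_apply, one_apply_eq_self,
      orthonormal_iff_ite.1 h, orthonormal_iff_ite.1 he]
  refine Unitary.mem_iff.2 ⟨h1, ?_⟩
  have h2 : (star A : Op d).toLinearMap * A.toLinearMap = 1 := by
    rw [← ContinuousLinearMap.toLinearMap_mul, h1]; rfl
  rw [mul_eq_one_comm] at h2
  exact ContinuousLinearMap.coe_injective h2

lemma apply_eq_inner_smul_of_conj_rankOne_eq {A B : Op d} (hB : B ∈ unitary (Op d)) {x : E d}
    (hx : ‖x‖ = 1) (h : B * rankOne x x * star B = A * rankOne x x * star A) :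
    B x = inner ℂ (A x) (B x) • A x := by
  rw [mul_rankOne_mul_star, mul_rankOne_mul_star] at h
  have := congrArg (fun L : Op d => L (B x)) h
  rwa [rankOne_apply, rankOne_apply, inner_apply_of_mem_unitary hB, inner_self_eq_norm_sq_to_K, hx,
    RCLike.ofReal_one, one_pow, one_smul] at this

lemma HasDerivWithinAt.op_apply {V : ℝ → Op d} {V' : Op d} {s : Set ℝ} {t : ℝ}
    (h : HasDerivWithinAt V V' s t) (x : E d) :
    HasDerivWithinAt (fun u => V u x) (V' x) s t :=
  ((ContinuousLinearMap.apply ℂ (E d) x).restrictScalars ℝ).hasFDerivAt.comp_hasDerivWithinAt t h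

/-- The velocity of a differentiable curve of unitaries is skew-adjoint in the moving frame. -/
lemma re_inner_apply_deriv_eq_zero {T : ℝ} (hT : 0 < T) {Γ Γ' : ℝ → Op d}
    (hΓ : ∀ t ∈ Icc (0 : ℝ) T, HasDerivWithinAt Γ (Γ' t) (Icc (0 : ℝ) T) t)
    (hΓu : ∀ t ∈ Icc (0 : ℝ) T, Γ t ∈ unitary (Op d)) (x : E d)
    {t : ℝ} (ht : t ∈ Icc (0 : ℝ) T) : (inner ℂ (Γ t x) (Γ' t x)).re = 0 := by
  have h1 := ((hΓ t ht).op_apply x).inner ℂ ((hΓ t ht).op_apply x)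
  have h2 : HasDerivWithinAt (fun u => inner ℂ (Γ u x) (Γ u x)) 0 (Icc (0 : ℝ) T) t :=
    (hasDerivWithinAt_const t _ (inner ℂ x x)).congr_of_mem
      (fun u hu => inner_apply_of_mem_unitary (hΓu u hu) x x) ht
  have h3 := (uniqueDiffOn_Icc hT t ht).eq_deriv _ h1 h2
  have h4 := congrArg Complex.re h3
  rw [← inner_conj_symm (Γ' t x)] at h4
  simp only [Complex.add_re, Complex.conj_re, Complex.zero_re] at h4
  linarith

/-- A unimodular solution of `c' = -a c` for a continuous, purely imaginary coefficient `a`. -/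
lemma exists_phase {T : ℝ} (hT : 0 ≤ T) {a : ℝ → ℂ} (ha : ContinuousOn a (Icc 0 T))
    (hre : ∀ t ∈ Icc (0 : ℝ) T, (a t).re = 0) :
    ∃ c : ℝ → ℂ, c 0 = 1 ∧ (∀ t, ‖c t‖ = 1) ∧
      ∀ t ∈ Icc (0 : ℝ) T, HasDerivWithinAt c (-a t * c t) (Icc (0 : ℝ) T) t := by
  set β : ℝ → ℝ := IccExtend hT ((Icc (0 : ℝ) T).domRestrict fun t => (a t).im) with hβ
  have hβc : Continuous β :=
    (Complex.continuous_im.comp_continuousOn ha).domRestrict.Icc_extend'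
  refine ⟨fun t => Complex.exp ((-∫ s in (0 : ℝ)..t, β s : ℝ) * Complex.I), by simp,
    fun t => Complex.norm_exp_ofReal_mul_I _, fun t ht => ?_⟩
  have h := (((hβc.integral_hasStrictDerivAt 0 t).hasDerivAt.neg.ofReal_comp.mul_const
    Complex.I).cexp).hasDerivWithinAt (s := Icc (0 : ℝ) T)
  have hat : a t = (β t : ℂ) * Complex.I := by
    rw [hβ, IccExtend_of_mem hT _ ht]
    apply Complex.ext <;> simp [hre t ht, domRestrict_apply]
  refine h.congr_deriv ?_
  rw [hat]
  push_cast [Pi.neg_apply]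
  ring

/-- Two horizontal lifts of the same curve with the same initial point agree. -/
lemma IsHorizontalLift.eq_on {T : ℝ} {e : Fin d → E d} (he : Orthonormal ℂ e)
    {Γ : ℝ → Op d} {U₀ : Op d} {V W V₁ W₁ : ℝ → Op d}
    (h : IsHorizontalLift d T e Γ U₀ V W) (h₁ : IsHorizontalLift d T e Γ U₀ V₁ W₁)
    {t : ℝ} (ht : t ∈ Icc (0 : ℝ) T) : V₁ t = V t := by
  obtain ⟨hd, -, h0, hu, hP, hH⟩ := h
  obtain ⟨hd₁, -, h0₁, hu₁, hP₁, hH₁⟩ := h₁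
  refine he.op_ext fun n => ?_
  have hz : (0 : ℝ) ∈ Icc 0 T := ⟨le_rfl, ht.1.trans ht.2⟩
  have hk : ∀ s ∈ Icc (0 : ℝ) T,
      HasDerivWithinAt (fun u => inner ℂ (V u (e n)) (V₁ u (e n))) 0 (Icc (0 : ℝ) T) s := by
    intro s hs
    have hPs := (hP₁ n s hs).trans (hP n s hs).symm
    have e1 := apply_eq_inner_smul_of_conj_rankOne_eq (hu₁ s hs) (he.1 n) hPs
    have e2 := apply_eq_inner_smul_of_conj_rankOne_eq (hu s hs) (he.1 n) hPs.symm
    have H := hH n s hs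
    have H₁ := hH₁ n s hs
    rw [inner_star_mul_apply] at H H₁
    have z1 : inner ℂ (V s (e n)) (W₁ s (e n)) = 0 := by
      rw [e2, inner_smul_left, H₁, mul_zero]
    have z2 : inner ℂ (W s (e n)) (V₁ s (e n)) = 0 := by
      rw [e1, inner_smul_right, inner_eq_zero_symm.1 H, mul_zero]
    simpa [z1, z2] using ((hd s hs).op_apply (e n)).inner ℂ ((hd₁ s hs).op_apply (e n))
  have hconst := (convex_Icc (0 : ℝ) T).norm_image_sub_le_of_norm_hasDerivWithin_le
    (C := 0) hk (by simp) hz ht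
  rw [zero_mul, norm_le_zero_iff, sub_eq_zero, h0, h0₁, ← h0,
    inner_apply_of_mem_unitary (hu 0 hz), inner_self_eq_norm_sq_to_K, he.1 n] at hconst
  have e1 := apply_eq_inner_smul_of_conj_rankOne_eq (hu₁ t ht) (he.1 n)
    ((hP₁ n t ht).trans (hP n t ht).symm)
  rw [e1, hconst]
  simp

lemma sum_mul_rankOne_apply {e : Fin d → E d} (he : Orthonormal ℂ e)
    (A : Fin d → Op d) (n : Fin d) :
    (∑ m, A m * rankOne (e m) (e m)) (e n) = A n (e n) := by
  rw [sum_apply, Finset.sum_eq_single n]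
  · simp [rankOne_apply, inner_self_eq_norm_sq_to_K, he.1 n]
  · intro m _ hm
    simp [rankOne_apply, orthonormal_iff_ite.1 he, hm]
  · simp

/-- Rephasing the columns of `Γ` by the solutions of `c' = -⟨Γ e, Γ' e⟩ c` gives a horizontal
lift. -/
lemma exists_isHorizontalLift {T : ℝ} (hT : 0 ≤ T) {e : Fin d → E d} (he : Orthonormal ℂ e)
    {Γ Γ' : ℝ → Op d}
    (hΓ : ∀ t ∈ Icc (0 : ℝ) T, HasDerivWithinAt Γ (Γ' t) (Icc (0 : ℝ) T) t)
    (hΓ'c : ContinuousOn Γ' (Icc (0 : ℝ) T))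
    (hΓu : ∀ t ∈ Icc (0 : ℝ) T, Γ t ∈ unitary (Op d))
    (hre : ∀ n, ∀ t ∈ Icc (0 : ℝ) T, (inner ℂ (Γ t (e n)) (Γ' t (e n))).re = 0) :
    ∃ V W : ℝ → Op d, IsHorizontalLift d T e Γ (Γ 0) V W := by
  have hΓc : ContinuousOn Γ (Icc (0 : ℝ) T) := fun t ht => (hΓ t ht).continuousWithinAt
  have ha : ∀ n, ContinuousOn (fun t => inner ℂ (Γ t (e n)) (Γ' t (e n))) (Icc (0 : ℝ) T) :=
    fun n => (hΓc.clm_apply continuousOn_const).inner (hΓ'c.clm_apply continuousOn_const)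
  choose c hc0 hcn hcd using fun n => exists_phase hT (ha n) (hre n)
  have hcc : ∀ n, ContinuousOn (c n) (Icc (0 : ℝ) T) :=
    fun n t ht => (hcd n t ht).continuousWithinAt
  have hcsq : ∀ n t, c n t * (starRingEnd ℂ) (c n t) = 1 := fun n t => by
    rw [Complex.mul_conj']; simp [hcn n t]
  set a : Fin d → ℝ → ℂ := fun n t => inner ℂ (Γ t (e n)) (Γ' t (e n)) with ha_def
  set V : ℝ → Op d := fun t => ∑ n, (c n t • Γ t) * rankOne (e n) (e n) with hV
  set W : ℝ → Op d := fun t =>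
    ∑ n, (c n t • Γ' t + (-a n t * c n t) • Γ t) * rankOne (e n) (e n) with hW
  have hVe : ∀ t n, V t (e n) = c n t • Γ t (e n) := fun t n => by
    rw [hV]; exact sum_mul_rankOne_apply he (fun n => c n t • Γ t) n
  have hWe : ∀ t n, W t (e n) = c n t • Γ' t (e n) + (-a n t * c n t) • Γ t (e n) :=
    fun t n => by
      rw [hW]
      exact sum_mul_rankOne_apply he
        (fun n => c n t • Γ' t + (-a n t * c n t) • Γ t) n
  refine ⟨V, W, fun t ht => ?_, ?_, ?_, fun t ht => ?_, fun n t ht => ?_, fun n t ht => ?_⟩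
  · exact HasDerivWithinAt.fun_sum fun n _ => ((hcd n t ht).smul (hΓ t ht)).mul_const _
  · exact continuousOn_finsetSum _ fun n _ =>
      (((hcc n).smul hΓ'c).add (((ha n).neg.mul (hcc n)).smul hΓc)).mul continuousOn_const
  · refine he.op_ext fun n => ?_
    rw [hVe, hc0, one_smul]
  · refine he.mem_unitary (orthonormal_iff_ite.2 fun m n => ?_)
    rw [hVe, hVe, inner_smul_left, inner_smul_right, inner_apply_of_mem_unitary (hΓu t ht),
      orthonormal_iff_ite.1 he]
    split_ifs with hmn
    · subst hmn
      rw [mul_one, mul_comm, hcsq]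
    · simp
  · rw [mul_rankOne_mul_star, mul_rankOne_mul_star, hVe]
    ext1 h
    rw [rankOne_apply, rankOne_apply, inner_smul_left, smul_smul, mul_right_comm,
      mul_comm ((starRingEnd ℂ) _), hcsq, one_mul]
  · rw [inner_star_mul_apply, hVe, hWe, inner_add_right, inner_smul_right, inner_smul_right,
      inner_smul_left, inner_smul_left, inner_apply_of_mem_unitary (hΓu t ht),
      inner_self_eq_norm_sq_to_K, he.1 n]
    simp only [ha_def, map_one, one_pow]
    ring

end

theorem horizontal_lift_exists_unique (d : ℕ) (hd : 1 ≤ d) (T : ℝ) (hT : 0 ≤ T)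
    (e : Fin d → E d) (he : Orthonormal ℂ e)
    (Γ Γ' : ℝ → Op d) (U₀ : Op d)
    (hΓ : ∀ t ∈ Set.Icc (0 : ℝ) T, HasDerivWithinAt Γ (Γ' t) (Set.Icc (0 : ℝ) T) t)
    (hΓ'c : ContinuousOn Γ' (Set.Icc (0 : ℝ) T))
    (hΓu : ∀ t ∈ Set.Icc (0 : ℝ) T, Γ t ∈ unitary (Op d))
    (hΓ0 : Γ 0 = U₀) :
    ∃ V W : ℝ → Op d, IsHorizontalLift d T e Γ U₀ V W ∧
      ∀ V₁ W₁ : ℝ → Op d, IsHorizontalLift d T e Γ U₀ V₁ W₁ →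
        ∀ t ∈ Set.Icc (0 : ℝ) T, V₁ t = V t := by
  have hex : ∃ V W : ℝ → Op d, IsHorizontalLift d T e Γ U₀ V W := by
    subst hΓ0
    rcases hT.eq_or_lt with rfl | hT'
    · refine exists_isHorizontalLift (Γ' := 0) le_rfl he (fun t ht => ?_) continuousOn_const hΓu
        (by simp)
      obtain rfl : t = 0 := le_antisymm ht.2 ht.1
      rw [Icc_self]
      exact (hasFDerivWithinAt_singleton Γ 0).congr_fderiv (by simp)
    · exact exists_isHorizontalLift hT he hΓ hΓ'c hΓu
        fun n t ht => re_inner_apply_deriv_eq_zero hT' hΓ hΓu (e n) ht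
  obtain ⟨V, W, h⟩ := hex
  exact ⟨V, W, h, fun V₁ W₁ h₁ t ht => h.eq_on he h₁ ht⟩
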